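/- arXiv:2602.18251 — 4 statements merged into one kernel-verified Lean document; each statement's English description precedes it below -/
import Mathlib

section
/- Let n, d ≥ 1. For i = 1, 2, 3 let T_i = (Φ_i, f_i, B_i, h_i), where Φ_i : ℝⁿ × ℝ → ℝⁿ, f_i : ℝ → ℝ is differentiable with f_i'(t) ≥ 0 for all t, B_i : ℝⁿ × ℝ → (d×d real orthogonal matrices), and h_i : ℝⁿ × ℝ → ℝ^d. Define the composition T₂ ∘ T₁ = (Φ̃, f̃, B̃, h̃) by Φ̃(x,t) = Φ₂(Φ₁(x,t), f₁(t)), f̃ = f₂ ∘ f₁, B̃(x,t) = B₂(Φ₁(x,t), f₁(t))·B₁(x,t), and h̃(x,t) = h₁(x,t) + √(f₁'(t))·B₁(x,t)ᵀ·h₂(Φ₁(x,t), f₁(t)). Then this composition is associative: all four components of (T₃ ∘ T₂) ∘ T₁ and of T₃ ∘ (T₂ ∘ T₁) coincide as functions (where, when forming the composite, the derivative of f₂ ∘ f₁ at t equals f₂'(f₁(t))·f₁'(t) by the chain rule). (Associativity of the group law on stochastic transformations.) -/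
open Matrix

/-- A stochastic transformation datum `T = (Φ, f, B, h)` for an SDE on `ℝⁿ`
driven by a `d`-dimensional Brownian motion: a time-dependent space map, a time
change, a matrix-valued rotation and a Girsanov drift. -/
def StochTransf (n d : ℕ) :=
  ((Fin n → ℝ) × ℝ → (Fin n → ℝ)) × (ℝ → ℝ) ×
    ((Fin n → ℝ) × ℝ → Matrix (Fin d) (Fin d) ℝ) ×
    ((Fin n → ℝ) × ℝ → (Fin d → ℝ))

/-- Composition of stochastic transformations:
`Φ̃(x,t) = Φ₂(Φ₁(x,t), f₁(t))`, `f̃ = f₂ ∘ f₁`,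
`B̃(x,t) = B₂(Φ₁(x,t), f₁(t))·B₁(x,t)` and
`h̃(x,t) = h₁(x,t) + √(f₁'(t))·B₁(x,t)ᵀ·h₂(Φ₁(x,t), f₁(t))`. -/
noncomputable def stochComp {n d : ℕ} (T₂ T₁ : StochTransf n d) :
    StochTransf n d :=
  (fun p => T₂.1 (T₁.1 p, T₁.2.1 p.2),
   T₂.2.1 ∘ T₁.2.1,
   fun p => T₂.2.2.1 (T₁.1 p, T₁.2.1 p.2) * T₁.2.2.1 p,
   fun p => T₁.2.2.2 p +
     Real.sqrt (deriv T₁.2.1 p.2) •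
       (T₁.2.2.1 p)ᵀ.mulVec (T₂.2.2.2 (T₁.1 p, T₁.2.1 p.2)))

/-- Associativity of the composition of stochastic transformations: all four
components of `(T₃ ∘ T₂) ∘ T₁` and of `T₃ ∘ (T₂ ∘ T₁)` coincide as functions
(the derivative of `f₂ ∘ f₁` being computed by the chain rule). -/
theorem stochComp_assoc (n d : ℕ) (hn : 1 ≤ n) (hd : 1 ≤ d)
    (T₁ T₂ T₃ : StochTransf n d)
    (hf₁ : Differentiable ℝ T₁.2.1) (hf₂ : Differentiable ℝ T₂.2.1)
    (hf₃ : Differentiable ℝ T₃.2.1)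
    (hf₁' : ∀ t, 0 ≤ deriv T₁.2.1 t) (hf₂' : ∀ t, 0 ≤ deriv T₂.2.1 t)
    (hf₃' : ∀ t, 0 ≤ deriv T₃.2.1 t)
    (hB₁ : ∀ p, T₁.2.2.1 p * (T₁.2.2.1 p)ᵀ = 1)
    (hB₂ : ∀ p, T₂.2.2.1 p * (T₂.2.2.1 p)ᵀ = 1)
    (hB₃ : ∀ p, T₃.2.2.1 p * (T₃.2.2.1 p)ᵀ = 1) :
    stochComp (stochComp T₃ T₂) T₁ = stochComp T₃ (stochComp T₂ T₁) := by
  refine Prod.ext rfl (Prod.ext rfl (Prod.ext ?_ ?_))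
  · funext p
    exact Matrix.mul_assoc _ _ _
  · funext p
    have hd : deriv (T₂.2.1 ∘ T₁.2.1) p.2
        = deriv T₂.2.1 (T₁.2.1 p.2) * deriv T₁.2.1 p.2 :=
      deriv_comp p.2 (hf₂ _) (hf₁ _)
    simp only [stochComp]
    rw [hd, Real.sqrt_mul (hf₂' _), Matrix.transpose_mul, Matrix.mulVec_add,
      Matrix.mulVec_smul, Matrix.mulVec_mulVec, smul_add, smul_smul, add_assoc,
      mul_comm (Real.sqrt (deriv T₁.2.1 p.2))]
    rfl
end

section
/- Let n, d ≥ 1 and let T = (Φ, f, B, h), where f : ℝ → ℝ is a differentiable bijection with f'(t) > 0 for all t (so f⁻¹ is differentiable with (f⁻¹)'(t) = 1/f'(f⁻¹(t))), Φ : ℝⁿ × ℝ → ℝⁿ is such that Φ(·, t) : ℝⁿ → ℝⁿ is a bijection for every t, B : ℝⁿ × ℝ → (d×d real orthogonal matrices), and h : ℝⁿ × ℝ → ℝ^d. Define T⁻¹ = (Φ̄, f⁻¹, B̄, h̄) by Φ̄(x,t) = (Φ(·, f⁻¹(t)))⁻¹(x), B̄(x,t) = B(Φ̄(x,t), f⁻¹(t))ᵀ,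 and h̄(x,t) = −(f'(f⁻¹(t)))^{−1/2}·B(Φ̄(x,t), f⁻¹(t))·h(Φ̄(x,t), f⁻¹(t)). Then, under the composition (T₂ ∘ T₁)(x,t) = (Φ₂(Φ₁(x,t), f₁(t)), (f₂ ∘ f₁)(t), B₂(Φ₁(x,t), f₁(t))·B₁(x,t), h₁(x,t) + √(f₁'(t))·B₁(x,t)ᵀ·h₂(Φ₁(x,t), f₁(t))), both T ∘ T⁻¹ and T⁻¹ ∘ T equal the neutral transformation T₀ = ((x,t) ↦ x, id, I_d, 0). (The inverse of a stochastic transformation.) -/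
open Matrix

/-- The neutral stochastic transformation `T₀ = ((x,t) ↦ x, id, I_d, 0)`. -/
def stochNeutral (n d : ℕ) : StochTransf n d :=
  (fun p => p.1, id, fun _ => 1, fun _ => 0)

/-- The inverse of a stochastic transformation `T = (Φ, f, B, h)`:
`T⁻¹ = (Φ̄, f⁻¹, B̄, h̄)` with `Φ̄(x,t) = (Φ(·, f⁻¹(t)))⁻¹(x)`,
`B̄(x,t) = B(Φ̄(x,t), f⁻¹(t))ᵀ` and
`h̄(x,t) = −(f'(f⁻¹(t)))^{−1/2}·B(Φ̄(x,t), f⁻¹(t))·h(Φ̄(x,t), f⁻¹(t))`.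
Both `T ∘ T⁻¹` and `T⁻¹ ∘ T` equal the neutral transformation `T₀`. -/
theorem stochComp_inverse (n d : ℕ) (hn : 1 ≤ n) (hd : 1 ≤ d)
    (Φ : (Fin n → ℝ) × ℝ → (Fin n → ℝ)) (f : ℝ → ℝ)
    (B : (Fin n → ℝ) × ℝ → Matrix (Fin d) (Fin d) ℝ)
    (h : (Fin n → ℝ) × ℝ → (Fin d → ℝ))
    (finv : ℝ → ℝ) (Φinv : (Fin n → ℝ) × ℝ → (Fin n → ℝ))
    (hf : Differentiable ℝ f) (hf' : ∀ t, 0 < deriv f t)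
    (hfbij : Function.Bijective f)
    (hfinv_left : Function.LeftInverse finv f)
    (hfinv_right : Function.RightInverse finv f)
    (hΦbij : ∀ t, Function.Bijective fun x => Φ (x, t))
    (hΦinv_left : ∀ x t, Φinv (Φ (x, finv t), t) = x)
    (hΦinv_right : ∀ x t, Φ (Φinv (x, t), finv t) = x)
    (hB : ∀ p, B p * (B p)ᵀ = 1) :
    stochComp (Φ, f, B, h)
        (Φinv, finv,
          fun p => (B (Φinv p, finv p.2))ᵀ,
          fun p => -((Real.sqrt (deriv f (finv p.2)))⁻¹ •
            (B (Φinv p, finv p.2)).mulVec (h (Φinv p, finv p.2))))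
      = stochNeutral n d ∧
    stochComp
        (Φinv, finv,
          fun p => (B (Φinv p, finv p.2))ᵀ,
          fun p => -((Real.sqrt (deriv f (finv p.2)))⁻¹ •
            (B (Φinv p, finv p.2)).mulVec (h (Φinv p, finv p.2))))
        (Φ, f, B, h)
      = stochNeutral n d := by
  have hmono : StrictMono f := strictMono_of_deriv_pos hf'
  have hcont : Continuous finv :=
    (StrictMono.orderIsoOfRightInverse f hmono finv hfinv_right).symm.continuous
  have hderiv : ∀ t, deriv finv t = (deriv f (finv t))⁻¹ := fun t =>
    (HasDerivAt.of_local_left_inverse hcont.continuousAt (hf (finv t)).hasDerivAt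
      (hf' (finv t)).ne' (Filter.Eventually.of_forall hfinv_right)).deriv
  have hB' : ∀ p, (B p)ᵀ * B p = 1 := fun p => mul_eq_one_comm.mp (hB p)
  have hΦl : ∀ x t, Φinv (Φ (x, t), f t) = x := fun x t => by
    have := hΦinv_left x (f t)
    rwa [hfinv_left t] at this
  have hs : ∀ t, Real.sqrt (deriv f t) ≠ 0 := fun t => (Real.sqrt_pos.mpr (hf' t)).ne'
  constructor
  · refine Prod.ext ?_ (Prod.ext ?_ (Prod.ext ?_ ?_))
    · funext p
      exact hΦinv_right p.1 p.2
    · funext t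
      exact hfinv_right t
    · funext p
      exact hB _
    · funext p
      simp only [stochComp, stochNeutral, hderiv, Real.sqrt_inv, Matrix.transpose_transpose]
      exact neg_add_cancel _
  · refine Prod.ext ?_ (Prod.ext ?_ (Prod.ext ?_ ?_))
    · funext p
      exact hΦl p.1 p.2
    · funext t
      exact hfinv_left t
    · funext p
      have h1 : Φinv (Φ p, f p.2) = p.1 := hΦl p.1 p.2
      simp only [stochComp, stochNeutral, h1, hfinv_left p.2]
      exact hB' p
    · funext p
      have h1 : Φinv (Φ p, f p.2) = p.1 := hΦl p.1 p.2
      simp only [stochComp, stochNeutral, h1, hfinv_left p.2, Matrix.mulVec_neg,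
        Matrix.mulVec_smul, Matrix.mulVec_mulVec, hB', Matrix.one_mulVec, smul_neg, smul_smul,
        mul_inv_cancel₀ (hs p.2), one_smul]
      exact add_neg_cancel _
end

section
/- Let Y : ℝ × ℝ → ℝ admit continuous partial derivatives ∂_t Y, ∂_x Y and ∂_{xx} Y, let m : ℝ → ℝ be differentiable, and let H : ℝ × ℝ → ℝ. Then the following are equivalent: (i) for all (x,t), ∂_x Y(x,t) = (1/2)·m'(t) and H(x,t) = −∂_t Y(x,t) − (1/2)·∂_{xx} Y(x,t); (ii) m' is differentiable, the function β(t) := Y(0,t) is differentiable, and for all (x,t), Y(x,t) = (1/2)·m'(t)·x + β(t) and H(x,t) = −(1/2)·(m')'(t)·x − β'(t). (Complete solution of the infinitesimal determining equations for one-dimensional Brownian motion, yielding the two symmetry families V_α and V_β.) -/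
/-- Complete solution of the infinitesimal determining equations for
one-dimensional Brownian motion. An infinitesimal transformation
`V = (Y, m, 0, H)` satisfies the determining equations
`∂ₓY = m'/2` and `H = −∂ₜY − (1/2)·∂ₓₓY` if and only if
`Y(x,t) = (1/2)·m'(t)·x + β(t)` and `H(x,t) = −(1/2)·m''(t)·x − β'(t)`
with `β(t) = Y(0,t)`, `m'` and `β` differentiable: these are the two
symmetry families `V_α` and `V_β`. -/
theorem brownian_determining_equations_solution
    (Y : ℝ × ℝ → ℝ) (m : ℝ → ℝ) (H : ℝ × ℝ → ℝ)
    (hYx : ∀ t, Differentiable ℝ fun x => Y (x, t))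
    (hYt : ∀ x, Differentiable ℝ fun s => Y (x, s))
    (hYxx : ∀ t, Differentiable ℝ fun x => deriv (fun x' => Y (x', t)) x)
    (hYx_cont : Continuous fun p : ℝ × ℝ => deriv (fun x => Y (x, p.2)) p.1)
    (hYt_cont : Continuous fun p : ℝ × ℝ => deriv (fun s => Y (p.1, s)) p.2)
    (hYxx_cont : Continuous fun p : ℝ × ℝ =>
      deriv (fun x => deriv (fun x' => Y (x', p.2)) x) p.1)
    (hm : Differentiable ℝ m) :
    (∀ x t, deriv (fun x' => Y (x', t)) x = deriv m t / 2 ∧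
        H (x, t) = -deriv (fun s => Y (x, s)) t
          - (1 / 2) * deriv (fun x' => deriv (fun x'' => Y (x'', t)) x') x)
    ↔
    (Differentiable ℝ (deriv m) ∧ (Differentiable ℝ fun t => Y (0, t)) ∧
      ∀ x t, Y (x, t) = deriv m t / 2 * x + Y (0, t) ∧
        H (x, t) = -(deriv (deriv m) t / 2) * x
          - deriv (fun s => Y (0, s)) t) := by
  have key : Differentiable ℝ (deriv m) →
      (∀ x t, Y (x, t) = deriv m t / 2 * x + Y (0, t)) → ∀ x t,
      deriv (fun x' => Y (x', t)) x = deriv m t / 2 ∧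
      deriv (fun s => Y (x, s)) t
        = deriv (deriv m) t / 2 * x + deriv (fun s => Y (0, s)) t := by
    intro hd hY x t
    constructor
    · have h : HasDerivAt (fun x' => deriv m t / 2 * x' + Y (0, t)) (deriv m t / 2 * 1) x :=
        ((hasDerivAt_id x).const_mul (deriv m t / 2)).add_const _
      have e : (fun x' => Y (x', t)) = fun x' => deriv m t / 2 * x' + Y (0, t) :=
        funext fun x' => hY x' t
      rw [e, h.deriv, mul_one]
    · have h : HasDerivAt (fun s => deriv m s / 2 * x + Y (0, s))
          (deriv (deriv m) t / 2 * x + deriv (fun s => Y (0, s)) t) t :=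
        (((hd t).hasDerivAt.div_const 2).mul_const x).add ((hYt 0) t).hasDerivAt
      have e : (fun s => Y (x, s)) = fun s => deriv m s / 2 * x + Y (0, s) :=
        funext fun s => hY x s
      rw [e, h.deriv]
  have key2 : (∀ x t, deriv (fun x' => Y (x', t)) x = deriv m t / 2) → ∀ x t,
      deriv (fun x' => deriv (fun x'' => Y (x'', t)) x') x = 0 := by
    intro h x t
    have e : (fun x' => deriv (fun x'' => Y (x'', t)) x') = fun _ => deriv m t / 2 :=
      funext fun x' => h x' t
    rw [e, deriv_const]
  constructor
  · intro h
    have hY : ∀ x t, Y (x, t) = deriv m t / 2 * x + Y (0, t) := by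
      intro x t
      have hg : ∀ y, HasDerivAt (fun x' => Y (x', t) - deriv m t / 2 * x') 0 y := by
        intro y
        have h1 := ((hYx t) y).hasDerivAt.sub
          ((hasDerivAt_id y).const_mul (deriv m t / 2))
        rw [(h y t).1, mul_one, sub_self] at h1
        exact h1
      have := is_const_of_deriv_eq_zero (fun y => (hg y).differentiableAt)
        (fun y => (hg y).deriv) x 0
      simp only [mul_zero, sub_zero] at this
      linarith
    have hd : Differentiable ℝ (deriv m) := by
      have e : deriv m = fun t => 2 * (Y (1, t) - Y (0, t)) := by
        funext t
        have := hY 1 t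
        linarith
      rw [e]
      exact ((hYt 1).sub (hYt 0)).const_mul 2
    refine ⟨hd, hYt 0, fun x t => ⟨hY x t, ?_⟩⟩
    rw [(h x t).2, key2 (fun x t => (h x t).1) x t, (key hd hY x t).2]
    ring
  · rintro ⟨hd, -, h⟩ x t
    have hY := fun x t => (h x t).1
    refine ⟨(key hd hY x t).1, ?_⟩
    rw [(h x t).2, key2 (fun x t => (key hd hY x t).1) x t, (key hd hY x t).2]
    ring
end

section
/- Let n, d ≥ 1, let μ : ℝⁿ × ℝ → ℝⁿ and σ : ℝⁿ × ℝ → ℝ^{n×d} be continuous, and for a map Φ : ℝⁿ × ℝ → ℝⁿ that is twice continuously differentiable in x and continuously differentiable in t, with Φ(·, t) a bijection of ℝⁿ for each t, define the transformed coefficients E_Φ(μ, σ) := ( (x,t) ↦ L_{μ,σ}(Φ)(Φ(·,t)⁻¹(x), t), (x,t) ↦ (D_xΦ · σ)(Φ(·,t)⁻¹(x), t) ), where L_{μ,σ}(Φ)^k = ∂_t Φ^k + Σ_i μ_i ∂_{x_i} Φ^k + (1/2) Σ_{i,j} (σσᵀ)_{ij} ∂_{x_i}∂_{x_j} Φ^k.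 Then for two such maps Φ₁, Φ₂, with the composition (Φ₂ ∘ Φ₁)(x,t) := Φ₂(Φ₁(x,t), t) (assumed to satisfy the same regularity), one has E_{Φ₂∘Φ₁}(μ, σ) = E_{Φ₂}(E_{Φ₁}(μ, σ)). (Functoriality of the action of strong stochastic transformations on SDE coefficients: E_{T₂∘T₁} = E_{T₂} ∘ E_{T₁} for spatial diffeomorphisms.) -/
open Matrix

noncomputable section

variable {n d : ℕ}

/-- The generator `L_{μ,σ}` of the SDE `dX = μ dt + σ dW` applied componentwise
to a time-dependent map `Φ : ℝⁿ × ℝ → ℝⁿ`: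
`L(Φ)ᵏ = ∂ₜΦᵏ + Σᵢ μᵢ ∂ᵢΦᵏ + (1/2) Σᵢⱼ (σσᵀ)ᵢⱼ ∂ᵢ∂ⱼΦᵏ`. -/
def generatorApply (μ : (Fin n → ℝ) × ℝ → (Fin n → ℝ))
    (σ : (Fin n → ℝ) × ℝ → Matrix (Fin n) (Fin d) ℝ)
    (Φ : (Fin n → ℝ) × ℝ → (Fin n → ℝ)) :
    (Fin n → ℝ) × ℝ → (Fin n → ℝ) := fun p k =>
  deriv (fun s => Φ (p.1, s) k) p.2
    + ∑ i, μ p i * fderiv ℝ (fun y => Φ (y, p.2) k) p.1 (Pi.single i 1)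
    + (1 / 2) * ∑ i, ∑ j, (σ p * (σ p)ᵀ) i j *
        fderiv ℝ (fun y => fderiv ℝ (fun z => Φ (z, p.2) k) y (Pi.single j 1))
          p.1 (Pi.single i 1)

/-- The spatial Jacobian of `Φ` multiplied by `σ`: `(DₓΦ·σ)ᵏᵅ = Σᵢ ∂ᵢΦᵏ σᵢᵅ`. -/
def jacobianMulSigma (Φ : (Fin n → ℝ) × ℝ → (Fin n → ℝ))
    (σ : (Fin n → ℝ) × ℝ → Matrix (Fin n) (Fin d) ℝ) :
    (Fin n → ℝ) × ℝ → Matrix (Fin n) (Fin d) ℝ := fun p =>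
  Matrix.of fun k α =>
    ∑ i, fderiv ℝ (fun y => Φ (y, p.2) k) p.1 (Pi.single i 1) * σ p i α

/-- The transformed drift `E_Φ(μ) = L_{μ,σ}(Φ) ∘ (Φ(·,t)⁻¹, id)`. -/
def transfDrift (Φ : (Fin n → ℝ) × ℝ → (Fin n → ℝ))
    (μ : (Fin n → ℝ) × ℝ → (Fin n → ℝ))
    (σ : (Fin n → ℝ) × ℝ → Matrix (Fin n) (Fin d) ℝ) :
    (Fin n → ℝ) × ℝ → (Fin n → ℝ) := fun p =>
  generatorApply μ σ Φ (Function.invFun (fun y => Φ (y, p.2)) p.1, p.2)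

/-- The transformed diffusion coefficient `E_Φ(σ) = (DₓΦ·σ) ∘ (Φ(·,t)⁻¹, id)`. -/
def transfDiffusion (Φ : (Fin n → ℝ) × ℝ → (Fin n → ℝ))
    (σ : (Fin n → ℝ) × ℝ → Matrix (Fin n) (Fin d) ℝ) :
    (Fin n → ℝ) × ℝ → Matrix (Fin n) (Fin d) ℝ := fun p =>
  jacobianMulSigma Φ σ (Function.invFun (fun y => Φ (y, p.2)) p.1, p.2)

/-- Regularity of a time-dependent spatial diffeomorphism: `C²` in `x`,
continuously differentiable in `t`, and a bijection of `ℝⁿ` for every `t`. -/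
def IsRegularSpaceMap (Φ : (Fin n → ℝ) × ℝ → (Fin n → ℝ)) : Prop :=
  (∀ t, ContDiff ℝ 2 fun y => Φ (y, t)) ∧
  (∀ x, Differentiable ℝ fun s => Φ (x, s)) ∧
  (Continuous fun p : (Fin n → ℝ) × ℝ => deriv (fun s => Φ (p.1, s)) p.2) ∧
  (∀ t, Function.Bijective fun y => Φ (y, t))

theorem aux_joint {n : ℕ} (f : (Fin n → ℝ) × ℝ → ℝ) (y : Fin n → ℝ) (t : ℝ)
    (hx : DifferentiableAt ℝ (fun z => f (z, t)) y)
    (ht : ∀ z, Differentiable ℝ fun s => f (z, s))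
    (hc : Continuous fun p : (Fin n → ℝ) × ℝ => deriv (fun s => f (p.1, s)) p.2)
    (c : ℝ → (Fin n → ℝ)) (hcd : DifferentiableAt ℝ c t) (hy : c t = y) :
    HasDerivAt (fun s => f (c s, s))
      (deriv (fun s => f (y, s)) t + fderiv ℝ (fun z => f (z, t)) y (deriv c t)) t := by
  have h2 : HasDerivAt (fun s => f (c s, t)) (fderiv ℝ (fun z => f (z, t)) y (deriv c t)) t := by
    have := hx.hasFDerivAt
    rw [← hy] at this ⊢
    exact this.comp_hasDerivAt t hcd.hasDerivAt
  have h1 : HasDerivAt (fun s => f (c s, s) - f (c s, t)) (deriv (fun s => f (y, s)) t) t := by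
    rw [hasDerivAt_iff_isLittleO, Asymptotics.isLittleO_iff]
    intro ε hε
    have hcont := hc.continuousAt (x := (y, t))
    rw [Metric.continuousAt_iff] at hcont
    obtain ⟨δ, hδ, hb⟩ := hcont ε hε
    have hcc := Metric.continuousAt_iff.1 hcd.continuousAt δ hδ
    obtain ⟨η, hη, hcη⟩ := hcc
    filter_upwards [Metric.ball_mem_nhds t hδ, Metric.ball_mem_nhds t hη] with s hs1 hs2
    have hcs := hcη hs2
    rw [hy] at hcs
    have key := (convex_ball t δ).norm_image_sub_le_of_norm_hasDerivWithin_le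
      (f := fun r => f (c s, r) - r * deriv (fun s => f (y, s)) t)
      (f' := fun r => deriv (fun s' => f (c s, s')) r - 1 * deriv (fun s => f (y, s)) t)
      (C := ε) (x := t) (y := s)
      (fun r _ => (((ht (c s) r).hasDerivAt).sub
        ((hasDerivAt_id r).mul_const _)).hasDerivWithinAt)
      (fun r hr => by
        have : dist (c s, r) (y, t) < δ := by
          rw [Prod.dist_eq]; exact max_lt hcs hr
        have := hb this
        rw [Real.dist_eq] at this
        rw [one_mul, Real.norm_eq_abs]
        exact this.le)
      (Metric.mem_ball_self hδ) hs1
    refine le_trans (le_of_eq ?_) key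
    congr 1
    simp only [smul_eq_mul]
    ring
  have := h1.add h2
  refine this.congr_of_eventuallyEq (Filter.Eventually.of_forall fun s => ?_)
  simp

theorem aux_clm {n : ℕ} (L : (Fin n → ℝ) →L[ℝ] ℝ) (v : Fin n → ℝ) :
    L v = ∑ l, L (Pi.single l 1) * v l := by
  conv_lhs => rw [← Finset.univ_sum_single v, map_sum]
  refine Finset.sum_congr rfl fun l _ => ?_
  have : (Pi.single l (v l) : Fin n → ℝ) = v l • Pi.single l 1 := by
    rw [← Pi.single_smul]; simp
  rw [this, map_smul, smul_eq_mul, mul_comm]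

theorem aux_fderiv {n : ℕ} (f : (Fin n → ℝ) → (Fin n → ℝ)) (g : (Fin n → ℝ) → ℝ)
    (hf : Differentiable ℝ f) (hg : Differentiable ℝ g) (y v : Fin n → ℝ) :
    fderiv ℝ (fun z => g (f z)) y v
      = ∑ l, fderiv ℝ g (f y) (Pi.single l 1) * fderiv ℝ (fun z => f z l) y v := by
  have := fderiv_comp (𝕜 := ℝ) y (hg (f y)) (hf y)
  change fderiv ℝ (g ∘ f) y v = _
  rw [this, ContinuousLinearMap.comp_apply, aux_clm]
  refine Finset.sum_congr rfl fun l _ => ?_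
  rw [fderiv_apply (hf y) l]
  rfl

theorem aux_fderiv2 {n : ℕ} (f : (Fin n → ℝ) → (Fin n → ℝ)) (g : (Fin n → ℝ) → ℝ)
    (hf : ContDiff ℝ 2 f) (hg : ContDiff ℝ 2 g) (y v w : Fin n → ℝ) :
    fderiv ℝ (fun x => fderiv ℝ (fun z => g (f z)) x v) y w
      = ∑ l, ((∑ m, fderiv ℝ (fun x => fderiv ℝ g x (Pi.single l 1)) (f y) (Pi.single m 1)
            * fderiv ℝ (fun z => f z m) y w) * fderiv ℝ (fun z => f z l) y v
          + fderiv ℝ g (f y) (Pi.single l 1)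
            * fderiv ℝ (fun x => fderiv ℝ (fun z => f z l) x v) y w) := by
  have hfd : Differentiable ℝ f := hf.differentiable (by norm_num)
  have hgd : Differentiable ℝ g := hg.differentiable (by norm_num)
  have hg1 : ∀ u, Differentiable ℝ (fun x => fderiv ℝ g x u) := fun u =>
    ((hg.fderiv_right (m := 1) (by norm_num)).differentiable (by norm_num)).clm_apply
      (differentiable_const u)
  have hfl : ∀ l, ContDiff ℝ 2 (fun z => f z l) := fun l => contDiff_pi.1 hf l
  have hf1 : ∀ l, Differentiable ℝ (fun x => fderiv ℝ (fun z => f z l) x v) := fun l =>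
    (((hfl l).fderiv_right (m := 1) (by norm_num)).differentiable (by norm_num)).clm_apply
      (differentiable_const v)
  have hgf : ∀ u, Differentiable ℝ (fun x => fderiv ℝ g (f x) u) := fun u => (hg1 u).comp hfd
  have : (fun x => fderiv ℝ (fun z => g (f z)) x v) = fun x =>
      ∑ l, fderiv ℝ g (f x) (Pi.single l 1) * fderiv ℝ (fun z => f z l) x v :=
    funext fun x => aux_fderiv f g hfd hgd x v
  rw [this, fderiv_fun_sum (fun l _ => (hgf _ y).fun_mul (hf1 l y)), ContinuousLinearMap.sum_apply]
  refine Finset.sum_congr rfl fun l _ => ?_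
  rw [fderiv_fun_mul (hgf _ y) (hf1 l y)]
  rw [← aux_fderiv f (fun x => fderiv ℝ g x (Pi.single l 1)) hfd (hg1 _) y w]
  simp only [ContinuousLinearMap.add_apply, ContinuousLinearMap.smul_apply, smul_eq_mul]
  ring

theorem aux_quad {n d : ℕ} (J K : Matrix (Fin n) (Fin n) ℝ) (S : Matrix (Fin n) (Fin d) ℝ) :
    ∑ i, ∑ j, (S * Sᵀ) i j * ∑ l, (∑ m, K m l * J m i) * J l j
      = ∑ m, ∑ l, ((J * S) * (J * S)ᵀ) m l * K m l := by
  have h1 : ∑ i, ∑ j, (S * Sᵀ) i j * ∑ l, (∑ m, K m l * J m i) * J l j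
      = Matrix.trace ((S * Sᵀ) * ((Jᵀ * K) * J)ᵀ) := by
    simp only [Matrix.trace, Matrix.diag, Matrix.mul_apply (M := S * Sᵀ), Matrix.transpose_apply,
      Matrix.mul_apply (N := J), Matrix.mul_apply (N := K)]
    simp only [mul_comm]
  have h2 : ∑ m, ∑ l, ((J * S) * (J * S)ᵀ) m l * K m l
      = Matrix.trace (((J * S) * (J * S)ᵀ) * Kᵀ) := by
    simp only [Matrix.trace, Matrix.diag, Matrix.mul_apply (N := Kᵀ), Matrix.transpose_apply]
  rw [h1, h2]
  simp only [Matrix.transpose_mul, Matrix.transpose_transpose]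
  rw [← Matrix.mul_assoc, ← Matrix.mul_assoc, Matrix.trace_mul_comm]
  simp only [Matrix.mul_assoc]

theorem aux_alg {n d : ℕ} (τ : ℝ) (G T M : Fin n → ℝ) (J K : Matrix (Fin n) (Fin n) ℝ)
    (H : Fin n → Fin n → Fin n → ℝ) (S : Matrix (Fin n) (Fin d) ℝ) :
    (τ + ∑ l, G l * T l) + ∑ i, M i * ∑ l, G l * J l i
      + (1 / 2) * ∑ i, ∑ j, (S * Sᵀ) i j * ∑ l, ((∑ m, K m l * J m i) * J l j + G l * H l i j)
    = τ + ∑ l, (T l + ∑ i, M i * J l i + (1 / 2) * ∑ i, ∑ j, (S * Sᵀ) i j * H l i j) * G l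
      + (1 / 2) * ∑ m, ∑ l, ((J * S) * (J * S)ᵀ) m l * K m l := by
  rw [← aux_quad]
  have e1 : ∑ i, M i * ∑ l, G l * J l i = ∑ l, (∑ i, M i * J l i) * G l := by
    simp only [Finset.mul_sum, Finset.sum_mul]
    rw [Finset.sum_comm]
    refine Finset.sum_congr rfl fun _ _ => Finset.sum_congr rfl fun _ _ => by ring
  have e2 : ∑ i, ∑ j, (S * Sᵀ) i j * ∑ l, G l * H l i j
      = ∑ l, (∑ i, ∑ j, (S * Sᵀ) i j * H l i j) * G l := by
    simp only [Finset.mul_sum, Finset.sum_mul]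
    rw [Finset.sum_comm' (t' := Finset.univ) (s' := fun _ => Finset.univ) (by simp)]
    rw [Finset.sum_comm, Finset.sum_congr rfl fun _ _ => Finset.sum_comm, Finset.sum_comm]
    refine Finset.sum_congr rfl fun _ _ => Finset.sum_congr rfl fun _ _ =>
      Finset.sum_congr rfl fun _ _ => by ring
  simp only [Finset.sum_add_distrib, mul_add, add_mul, e1, e2]
  have e3 : ∑ l, 1 / 2 * (∑ i, ∑ j, (S * Sᵀ) i j * H l i j) * G l
      = 1 / 2 * ∑ l, (∑ i, ∑ j, (S * Sᵀ) i j * H l i j) * G l := by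
    rw [Finset.mul_sum]; simp only [mul_assoc]
  rw [e3]
  simp only [mul_comm (G _) (T _)]
  ring

/-- Functoriality of the action of strong stochastic transformations on SDE
coefficients: `E_{Φ₂∘Φ₁}(μ, σ) = E_{Φ₂}(E_{Φ₁}(μ, σ))` for spatial
diffeomorphisms, where `(Φ₂ ∘ Φ₁)(x,t) = Φ₂(Φ₁(x,t), t)`. -/
theorem transf_coefficients_functorial (hn : 1 ≤ n) (hd : 1 ≤ d)
    (μ : (Fin n → ℝ) × ℝ → (Fin n → ℝ))
    (σ : (Fin n → ℝ) × ℝ → Matrix (Fin n) (Fin d) ℝ)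
    (hμ : Continuous μ) (hσ : Continuous σ)
    (Φ₁ Φ₂ : (Fin n → ℝ) × ℝ → (Fin n → ℝ))
    (hΦ₁ : IsRegularSpaceMap Φ₁) (hΦ₂ : IsRegularSpaceMap Φ₂)
    (hΦc : IsRegularSpaceMap fun p : (Fin n → ℝ) × ℝ => Φ₂ (Φ₁ p, p.2)) :
    transfDrift (fun p : (Fin n → ℝ) × ℝ => Φ₂ (Φ₁ p, p.2)) μ σ
        = transfDrift Φ₂ (transfDrift Φ₁ μ σ) (transfDiffusion Φ₁ σ) ∧
    transfDiffusion (fun p : (Fin n → ℝ) × ℝ => Φ₂ (Φ₁ p, p.2)) σ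
        = transfDiffusion Φ₂ (transfDiffusion Φ₁ σ) := by
  obtain ⟨c1, t1, k1, b1⟩ := hΦ₁
  obtain ⟨c2, t2, k2, b2⟩ := hΦ₂
  obtain ⟨-, -, -, bc⟩ := hΦc
  have inv1 : ∀ y t, Function.invFun (fun y => Φ₁ (y, t)) (Φ₁ (y, t)) = y := fun y t =>
    Function.leftInverse_invFun (b1 t).1 y
  have invc : ∀ z t, Function.invFun (fun y => Φ₂ (y, t)) z
      = Φ₁ (Function.invFun (fun y => Φ₂ (Φ₁ (y, t), t)) z, t) := fun z t => by
    apply (b2 t).1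
    have h1 := Function.rightInverse_invFun (b2 t).2 z
    have h2 := Function.rightInverse_invFun (bc t).2 z
    exact h1.trans h2.symm
  have drift1 : ∀ y t, transfDrift Φ₁ μ σ (Φ₁ (y, t), t) = generatorApply μ σ Φ₁ (y, t) :=
    fun y t => by simp only [transfDrift, inv1]
  have diff1 : ∀ y t, transfDiffusion Φ₁ σ (Φ₁ (y, t), t) = jacobianMulSigma Φ₁ σ (y, t) :=
    fun y t => by simp only [transfDiffusion, inv1]
  have d1 : ∀ t, Differentiable ℝ fun y => Φ₁ (y, t) := fun t =>
    (c1 t).differentiable (by norm_num)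
  have c2k : ∀ t k, ContDiff ℝ 2 fun y => Φ₂ (y, t) k := fun t k => contDiff_pi.1 (c2 t) k
  have d2k : ∀ t k, Differentiable ℝ fun y => Φ₂ (y, t) k := fun t k =>
    (c2k t k).differentiable (by norm_num)
  constructor
  · funext p k
    obtain ⟨z, t⟩ := p
    rw [transfDrift, transfDrift]
    simp only
    rw [invc z t]
    generalize Function.invFun (fun y => Φ₂ (Φ₁ (y, t), t)) z = y
    have ht2 : ∀ x, Differentiable ℝ fun s => Φ₂ (x, s) k := fun x =>
      differentiable_pi.1 (t2 x) k
    have hk2 : Continuous fun p : (Fin n → ℝ) × ℝ => deriv (fun s => Φ₂ (p.1, s) k) p.2 := by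
      have : (fun p : (Fin n → ℝ) × ℝ => deriv (fun s => Φ₂ (p.1, s) k) p.2)
          = fun p => deriv (fun s => Φ₂ (p.1, s)) p.2 k := by
        funext p
        rw [deriv_pi (fun i => differentiable_pi.1 (t2 p.1) i p.2)]
      rw [this]
      exact (continuous_apply k).comp k2
    have hder := (aux_joint (fun p => Φ₂ p k) (Φ₁ (y, t)) t (d2k t k _) ht2 hk2
      (fun s => Φ₁ (y, s)) (t1 y t) rfl).deriv
    rw [aux_clm, deriv_pi (fun i => differentiable_pi.1 (t1 y) i t)] at hder
    have hA := aux_alg (deriv (fun s => Φ₂ (Φ₁ (y, t), s) k) t)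
      (fun l => fderiv ℝ (fun x => Φ₂ (x, t) k) (Φ₁ (y, t)) (Pi.single l 1))
      (fun l => deriv (fun s => Φ₁ (y, s) l) t) (μ (y, t))
      (Matrix.of fun l i => fderiv ℝ (fun x => Φ₁ (x, t) l) y (Pi.single i 1))
      (Matrix.of fun m l => fderiv ℝ (fun x => fderiv ℝ (fun x => Φ₂ (x, t) k) x (Pi.single l 1))
        (Φ₁ (y, t)) (Pi.single m 1))
      (fun l i j => fderiv ℝ (fun x => fderiv ℝ (fun x => Φ₁ (x, t) l) x (Pi.single j 1)) y
        (Pi.single i 1)) (σ (y, t))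
    have hJ : jacobianMulSigma Φ₁ σ (y, t)
        = (Matrix.of fun l i => fderiv ℝ (fun x => Φ₁ (x, t) l) y (Pi.single i 1)) * σ (y, t) := by
      ext k α
      simp [jacobianMulSigma, Matrix.mul_apply]
    simp only [generatorApply, drift1, diff1, hJ]
    simp only [aux_fderiv2 _ (fun x => Φ₂ (x, t) k) (c1 t) (c2k t k)]
    simp only [aux_fderiv _ (fun x => Φ₂ (x, t) k) (d1 t) (d2k t k), hder]
    simpa only [Matrix.of_apply] using hA
  · funext p
    obtain ⟨z, t⟩ := p
    rw [transfDiffusion, transfDiffusion]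
    simp only
    rw [invc z t]
    generalize Function.invFun (fun y => Φ₂ (Φ₁ (y, t), t)) z = y
    ext k α
    simp only [jacobianMulSigma, Matrix.of_apply, diff1]
    simp only [aux_fderiv _ (fun x => Φ₂ (x, t) k) (d1 t) (d2k t k), Finset.mul_sum,
      Finset.sum_mul]
    rw [Finset.sum_comm]
    simp only [mul_assoc]

end
end
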